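/- arXiv:1509.03882 — 3 statements merged into one kernel-verified Lean document; each statement's English description precedes it below -/
import Mathlib

section
/- (Equivalence of the J and K criteria.) Let (a_n)_{n≥1} and (b_n)_{n≥1} be nonincreasing sequences with values in [0,1] such that a_1 = b_1 = 1, a_n → 0, Σ_{n≥1} a_n = ∞ and Σ_{n≥1} b_n = ∞. Then Σ_{n=1}^∞ n (a_n − a_{n+1}) / (Σ_{k=1}^n b_k) = ∞ if and only if Σ_{n=1}^∞ (1 − n b_n/(Σ_{k=1}^n b_k)) · a_n/(Σ_{k=1}^n b_k) = ∞. (Here all terms of the second series are nonnegative, since b is nonincreasing.) -/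
open Filter

/-- Summation by parts for a nonnegative monotone weight against an antitone null sequence. -/
theorem summable_mul_sub_succ_iff {F A : ℕ → ℝ} (hF : Monotone F) (hF0 : 0 ≤ F 0)
    (hA : Antitone A) (hA0 : Tendsto A atTop (nhds 0)) :
    (Summable fun n => F n * (A n - A (n + 1))) ↔
      Summable fun n => (F (n + 1) - F n) * A (n + 1) := by
  have hFn (n : ℕ) : 0 ≤ F n := hF0.trans (hF n.zero_le)
  have hAn (n : ℕ) : 0 ≤ A n := hA.le_of_tendsto hA0 n
  have hl (n : ℕ) : 0 ≤ F n * (A n - A (n + 1)) :=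
    mul_nonneg (hFn n) (sub_nonneg.2 (hA n.le_succ))
  have hr (n : ℕ) : 0 ≤ (F (n + 1) - F n) * A (n + 1) :=
    mul_nonneg (sub_nonneg.2 (hF n.le_succ)) (hAn _)
  have parts (N : ℕ) : ∑ n ∈ Finset.range N, F n * (A n - A (n + 1)) + F N * A N =
      F 0 * A 0 + ∑ n ∈ Finset.range N, (F (n + 1) - F n) * A (n + 1) := by
    induction N with
    | zero => simp
    | succ N ih =>
      rw [Finset.sum_range_succ, Finset.sum_range_succ]
      linear_combination ih
  constructor
  · intro h
    have boundary (N : ℕ) : F N * A N ≤ ∑' n, F n * (A n - A (n + 1)) := by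
      have key (M : ℕ) (hM : N ≤ M) :
          F N * (A N - A M) ≤ ∑ n ∈ Finset.range M, F n * (A n - A (n + 1)) := by
        induction M, hM using Nat.le_induction with
        | base => simpa using Finset.sum_nonneg fun n _ => hl n
        | succ M hM ih =>
          rw [Finset.sum_range_succ]
          have := mul_le_mul_of_nonneg_right (hF hM) (sub_nonneg.2 (hA M.le_succ))
          linarith
      have lim : Tendsto (fun M => F N * (A N - A M)) atTop (nhds (F N * (A N - 0))) :=
        (tendsto_const_nhds.sub hA0).const_mul _
      rw [sub_zero] at lim
      refine le_of_tendsto lim ?_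
      filter_upwards [eventually_ge_atTop N] with M hM
      exact (key M hM).trans (h.sum_le_tsum _ fun n _ => hl n)
    refine summable_of_sum_range_le
      (c := 2 * ∑' n, F n * (A n - A (n + 1))) hr fun N => ?_
    have := h.sum_le_tsum (Finset.range N) fun n _ => hl n
    linarith [parts N, boundary N, mul_nonneg hF0 (hAn 0)]
  · intro h
    refine summable_of_sum_range_le
      (c := F 0 * A 0 + ∑' n, (F (n + 1) - F n) * A (n + 1)) hl fun N => ?_
    have := h.sum_le_tsum (Finset.range N) fun n _ => hr n
    linarith [parts N, mul_nonneg (hFn N) (hAn N)]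

/-- equivalence of the `J` and `K` criteria. For nonincreasing
`[0,1]`-valued sequences `(a_n)_{n≥1}`, `(b_n)_{n≥1}` with `a_1 = b_1 = 1`, `a_n → 0` and
divergent series, the series `Σ n (a_n − a_{n+1}) / (Σ_{k≤n} b_k)` diverges if and only if
the series `Σ (1 − n b_n / Σ_{k≤n} b_k) · a_n / (Σ_{k≤n} b_k)` diverges. -/
theorem J_eq_K_criterion (a b : ℕ → ℝ)
    (hamono : ∀ n, 1 ≤ n → a (n + 1) ≤ a n) (hbmono : ∀ n, 1 ≤ n → b (n + 1) ≤ b n)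
    (ha01 : ∀ n, 1 ≤ n → a n ∈ Set.Icc (0 : ℝ) 1)
    (hb01 : ∀ n, 1 ≤ n → b n ∈ Set.Icc (0 : ℝ) 1)
    (ha1 : a 1 = 1) (hb1 : b 1 = 1)
    (ha0 : Tendsto a atTop (nhds 0))
    (hadiv : ¬ Summable fun n => a (n + 1))
    (hbdiv : ¬ Summable fun n => b (n + 1)) :
    (¬ Summable fun n : ℕ =>
        ((n : ℝ) + 1) * (a (n + 1) - a (n + 2)) / ∑ k ∈ Finset.Icc 1 (n + 1), b k) ↔
    (¬ Summable fun n : ℕ =>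
        (1 - ((n : ℝ) + 1) * b (n + 1) / ∑ k ∈ Finset.Icc 1 (n + 1), b k) *
          (a (n + 1) / ∑ k ∈ Finset.Icc 1 (n + 1), b k)) := by
  set S : ℕ → ℝ := fun n => ∑ k ∈ Finset.Icc 1 (n + 1), b k with hS
  have S_zero : S 0 = 1 := by simp [hS, hb1]
  have S_succ (n : ℕ) : S (n + 1) = S n + b (n + 2) :=
    Finset.sum_Icc_succ_top (by omega) b
  have one_le_S (n : ℕ) : 1 ≤ S n := by
    induction n with
    | zero => exact S_zero.ge
    | succ n ih => linarith [S_succ n, (hb01 (n + 2) (by omega)).1]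
  have S_pos (n : ℕ) : 0 < S n := one_pos.trans_le (one_le_S n)
  have mul_b_le (n : ℕ) : ((n : ℝ) + 1) * b (n + 1) ≤ S n := by
    induction n with
    | zero => simp [S_zero, hb1]
    | succ n ih =>
      have := mul_le_mul_of_nonneg_left (hbmono (n + 1) (by omega))
        (by positivity : (0 : ℝ) ≤ n + 1)
      rw [S_succ]
      push_cast
      linarith
  have hA : Antitone fun n => a (n + 1) := antitone_nat_of_succ_le fun n => hamono _ (by omega)
  have hA0 : Tendsto (fun n => a (n + 1)) atTop (nhds 0) := (tendsto_add_atTop_iff_nat 1).2 ha0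
  set F : ℕ → ℝ := fun n => ((n : ℝ) + 1) / S n with hFdef
  set K : ℕ → ℝ := fun n => (1 - ((n : ℝ) + 1) * b (n + 1) / S n) * (a (n + 1) / S n) with hK
  have factor_nonneg (n : ℕ) : 0 ≤ 1 - ((n : ℝ) + 1) * b (n + 1) / S n :=
    sub_nonneg.2 ((div_le_one (S_pos n)).2 (mul_b_le n))
  have K_nonneg (n : ℕ) : 0 ≤ K n :=
    mul_nonneg (factor_nonneg n) (div_nonneg (ha01 _ (by omega)).1 (S_pos n).le)
  have F_diff (n : ℕ) :
      F (n + 1) - F n = (1 - (((n + 1 : ℕ) : ℝ) + 1) * b (n + 1 + 1) / S (n + 1)) / S n := by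
    have h0 := (S_pos n).ne'
    have h1 := (S_pos (n + 1)).ne'
    simp only [hFdef]
    field_simp
    push_cast
    linear_combination (-(n : ℝ) - 2) * S_succ n
  have hF : Monotone F := monotone_nat_of_le_succ fun n => by
    have := div_nonneg (factor_nonneg (n + 1)) (S_pos n).le
    linarith [F_diff n]
  have diff_mul (n : ℕ) :
      (F (n + 1) - F n) * a (n + 1 + 1) = S (n + 1) / S n * K (n + 1) := by
    have h0 := (S_pos n).ne'
    have h1 := (S_pos (n + 1)).ne'
    rw [F_diff]
    simp only [hK]
    field_simp
  have one_le_ratio (n : ℕ) : 1 ≤ S (n + 1) / S n := by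
    rw [one_le_div (S_pos n)]
    linarith [S_succ n, (hb01 (n + 2) (by omega)).1]
  have ratio_le_two (n : ℕ) : S (n + 1) / S n ≤ 2 := by
    rw [div_le_iff₀ (S_pos n)]
    linarith [S_succ n, (hb01 (n + 2) (by omega)).2, one_le_S n]
  have J_eq : (fun n : ℕ => ((n : ℝ) + 1) * (a (n + 1) - a (n + 2)) / S n) =
      fun n => F n * (a (n + 1) - a (n + 1 + 1)) := by
    funext n
    simp only [hFdef]
    ring
  refine not_congr ?_
  change Summable (fun n : ℕ => ((n : ℝ) + 1) * (a (n + 1) - a (n + 2)) / S n) ↔ Summable K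
  rw [J_eq, summable_mul_sub_succ_iff hF (by simp [hFdef, S_zero]) hA hA0,
    ← summable_nat_add_iff 1 (f := K)]
  simp only [diff_mul]
  constructor <;> intro h
  · exact h.of_nonneg_of_le (fun n => K_nonneg _)
      fun n => le_mul_of_one_le_left (K_nonneg _) (one_le_ratio n)
  · exact (h.mul_left 2).of_nonneg_of_le
      (fun n => mul_nonneg (zero_le_one.trans (one_le_ratio n)) (K_nonneg _))
      fun n => mul_le_mul_of_nonneg_right (ratio_le_two n) (K_nonneg _)
end

section
/- (Asymptotic comparison lemma.) Let (a_n), (b_n), (ã_n), (b̃_n) be nonincreasing [0,1]-valued sequences with a_1 = b_1 = ã_1 = b̃_1 = 1, all four having divergent series Σ a_n = Σ b_n = Σ ã_n = Σ b̃_n = ∞, and suppose that for all sufficiently large n, a_n ≤ ã_n and b_n ≥ b̃_n. If K := Σ_{n=1}^∞ (1 − n b_n/(Σ_{k=1}^n b_k)) · a_n/(Σ_{k=1}^n b_k) = ∞, then K̃ := Σ_{n=1}^∞ (1 − n b̃_n/(Σ_{k=1}^n b̃_k)) · ã_n/(Σ_{k=1}^n b̃_k) = ∞. -/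
open Filter

/-- Summation by parts shows that the increments of `g`, weighted by a nonincreasing nonnegative
sequence, are summable as soon as those of a sequence dominating `g` up to a constant are. -/
theorem summable_mul_sub_of_le_mul {α g h : ℕ → ℝ} {C : ℝ} (hα : Antitone α)
    (hα0 : ∀ n, 0 ≤ α n) (hg : Monotone g) (hg0 : 0 ≤ g 0) (hh : Monotone h) (hC : 0 ≤ C)
    (hgh : ∀ n, g n ≤ C * h n) (hs : Summable fun n => α (n + 1) * (h (n + 1) - h n)) :
    Summable fun n => α (n + 1) * (g (n + 1) - g n) := by
  have abel (f : ℕ → ℝ) (N : ℕ) :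
      ∑ i ∈ Finset.range N, α (i + 1) * (f (i + 1) - f i) + α 0 * f 0 =
        α N * f N + ∑ i ∈ Finset.range N, (α i - α (i + 1)) * f i := by
    induction N with
    | zero => simp
    | succ N ih => rw [Finset.sum_range_succ, Finset.sum_range_succ]; linarith
  refine summable_of_sum_range_le
    (c := C * (∑' n, α (n + 1) * (h (n + 1) - h n) + α 0 * h 0))
    (fun n => mul_nonneg (hα0 _) (sub_nonneg.2 (hg n.le_succ))) fun N => ?_
  have hle := hs.sum_le_tsum (Finset.range N)
    fun n _ => mul_nonneg (hα0 _) (sub_nonneg.2 (hh n.le_succ))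
  calc ∑ i ∈ Finset.range N, α (i + 1) * (g (i + 1) - g i)
      ≤ α N * g N + ∑ i ∈ Finset.range N, (α i - α (i + 1)) * g i := by
        rw [← abel]; exact le_add_of_nonneg_right (mul_nonneg (hα0 0) hg0)
    _ ≤ α N * (C * h N) + ∑ i ∈ Finset.range N, (α i - α (i + 1)) * (C * h i) := by
        gcongr with i
        · exact hα0 N
        · exact hgh N
        · exact sub_nonneg.2 (hα i.le_succ)
        · exact hgh i
    _ = C * (∑ i ∈ Finset.range N, α (i + 1) * (h (i + 1) - h i) + α 0 * h 0) := by
        rw [abel, mul_add, Finset.mul_sum]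
        congr 1
        · ring
        · exact Finset.sum_congr rfl fun _ _ => by ring
    _ ≤ _ := by gcongr

/-- The first `n + 1` terms of a nonincreasing sequence sum to at least `n + 1` times the last. -/
theorem succ_mul_le_sum_Icc {b : ℕ → ℝ} (hb : ∀ n, 1 ≤ n → b (n + 1) ≤ b n) (n : ℕ) :
    ((n : ℝ) + 1) * b (n + 1) ≤ ∑ k ∈ Finset.Icc 1 (n + 1), b k := by
  induction n with
  | zero => simp
  | succ n ih =>
    rw [Finset.sum_Icc_succ_top (by omega)]
    have := mul_le_mul_of_nonneg_left (hb (n + 1) (by omega)) (by positivity : (0 : ℝ) ≤ n + 1)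
    push_cast
    linarith

theorem one_le_sum_Icc {b : ℕ → ℝ} (hb0 : ∀ n, 1 ≤ n → 0 ≤ b n) (hb1 : b 1 = 1) (n : ℕ) :
    1 ≤ ∑ k ∈ Finset.Icc 1 (n + 1), b k := by
  rw [← hb1]
  exact Finset.single_le_sum (f := b) (fun k hk => hb0 k (Finset.mem_Icc.1 hk).1)
    (Finset.mem_Icc.2 ⟨le_rfl, by omega⟩)

/-- The increment of the reciprocal of the Cesàro mean of `b`. -/
theorem div_sum_Icc_sub_div_sum_Icc {b : ℕ → ℝ} (hb0 : ∀ n, 1 ≤ n → 0 ≤ b n) (hb1 : b 1 = 1)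
    (n : ℕ) :
    ((n + 1 : ℕ) + 1 : ℝ) / ∑ k ∈ Finset.Icc 1 (n + 1 + 1), b k -
        ((n : ℝ) + 1) / ∑ k ∈ Finset.Icc 1 (n + 1), b k =
      (∑ k ∈ Finset.Icc 1 (n + 1 + 1), b k) / (∑ k ∈ Finset.Icc 1 (n + 1), b k) *
        ((1 - ((n + 1 : ℕ) + 1 : ℝ) * b (n + 1 + 1) / ∑ k ∈ Finset.Icc 1 (n + 1 + 1), b k) /
          ∑ k ∈ Finset.Icc 1 (n + 1 + 1), b k) := by
  have h1 := one_le_sum_Icc hb0 hb1 n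
  have h2 := one_le_sum_Icc hb0 hb1 (n + 1)
  rw [Finset.sum_Icc_succ_top (by omega)] at h2 ⊢
  have h1' : (∑ k ∈ Finset.Icc 1 (n + 1), b k) ≠ 0 := by positivity
  have h2' : (∑ k ∈ Finset.Icc 1 (n + 1), b k) + b (n + 1 + 1) ≠ 0 := by positivity
  push_cast
  field_simp
  ring

theorem one_sub_div_sum_Icc_nonneg {b : ℕ → ℝ} (hb : ∀ n, 1 ≤ n → b (n + 1) ≤ b n)
    (hb0 : ∀ n, 1 ≤ n → 0 ≤ b n) (hb1 : b 1 = 1) (n : ℕ) :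
    0 ≤ 1 - ((n : ℝ) + 1) * b (n + 1) / ∑ k ∈ Finset.Icc 1 (n + 1), b k := by
  have h1 := one_le_sum_Icc hb0 hb1 n
  rw [sub_nonneg, div_le_one (by positivity)]
  exact succ_mul_le_sum_Icc hb n

theorem monotone_div_sum_Icc {b : ℕ → ℝ} (hb : ∀ n, 1 ≤ n → b (n + 1) ≤ b n)
    (hb0 : ∀ n, 1 ≤ n → 0 ≤ b n) (hb1 : b 1 = 1) :
    Monotone fun n : ℕ => ((n : ℝ) + 1) / ∑ k ∈ Finset.Icc 1 (n + 1), b k := by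
  refine monotone_nat_of_le_succ fun n => sub_nonneg.1 ?_
  rw [div_sum_Icc_sub_div_sum_Icc hb0 hb1]
  have h1 := one_le_sum_Icc hb0 hb1 n
  have h2 := one_le_sum_Icc hb0 hb1 (n + 1)
  have h3 := one_sub_div_sum_Icc_nonneg hb hb0 hb1 (n + 1)
  positivity

theorem summable_iff_summable_mul_sub {a b : ℕ → ℝ} (hb : ∀ n, 1 ≤ n → b (n + 1) ≤ b n)
    (ha0 : ∀ n, 1 ≤ n → 0 ≤ a n) (hb0 : ∀ n, 1 ≤ n → 0 ≤ b n) (hb1 : b 1 = 1) :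
    (Summable fun n : ℕ =>
      (1 - ((n : ℝ) + 1) * b (n + 1) / ∑ k ∈ Finset.Icc 1 (n + 1), b k) *
        (a (n + 1) / ∑ k ∈ Finset.Icc 1 (n + 1), b k)) ↔
    Summable fun n : ℕ => a (n + 1 + 1) *
      (((n + 1 : ℕ) + 1 : ℝ) / ∑ k ∈ Finset.Icc 1 (n + 1 + 1), b k -
        ((n : ℝ) + 1) / ∑ k ∈ Finset.Icc 1 (n + 1), b k) := by
  rw [← summable_nat_add_iff 1]
  have hterm (n : ℕ) : 0 ≤
      (1 - ((n : ℝ) + 1) * b (n + 1) / ∑ k ∈ Finset.Icc 1 (n + 1), b k) *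
        (a (n + 1) / ∑ k ∈ Finset.Icc 1 (n + 1), b k) := by
    have h1 := one_le_sum_Icc hb0 hb1 n
    exact mul_nonneg (one_sub_div_sum_Icc_nonneg hb hb0 hb1 n)
      (div_nonneg (ha0 _ (by omega)) (by positivity))
  have hratio (n : ℕ) :
      1 ≤ (∑ k ∈ Finset.Icc 1 (n + 1 + 1), b k) / ∑ k ∈ Finset.Icc 1 (n + 1), b k ∧
      (∑ k ∈ Finset.Icc 1 (n + 1 + 1), b k) / ∑ k ∈ Finset.Icc 1 (n + 1), b k ≤ 2 := by
    have h1 := one_le_sum_Icc hb0 hb1 n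
    have hle : b (n + 1 + 1) ≤ ∑ k ∈ Finset.Icc 1 (n + 1), b k :=
      (hb _ (by omega)).trans (Finset.single_le_sum (f := b)
        (fun k hk => hb0 k (Finset.mem_Icc.1 hk).1) (Finset.mem_Icc.2 ⟨by omega, le_rfl⟩))
    have h0 := hb0 (n + 1 + 1) (by omega)
    rw [Finset.sum_Icc_succ_top (by omega), le_div_iff₀ (by positivity),
      div_le_iff₀ (by positivity)]
    constructor <;> linarith
  have heq (n : ℕ) : a (n + 1 + 1) *
      (((n + 1 : ℕ) + 1 : ℝ) / ∑ k ∈ Finset.Icc 1 (n + 1 + 1), b k -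
        ((n : ℝ) + 1) / ∑ k ∈ Finset.Icc 1 (n + 1), b k) =
      (∑ k ∈ Finset.Icc 1 (n + 1 + 1), b k) / (∑ k ∈ Finset.Icc 1 (n + 1), b k) *
      ((1 - ((n + 1 : ℕ) + 1 : ℝ) * b (n + 1 + 1) / ∑ k ∈ Finset.Icc 1 (n + 1 + 1), b k) *
        (a (n + 1 + 1) / ∑ k ∈ Finset.Icc 1 (n + 1 + 1), b k)) := by
    rw [div_sum_Icc_sub_div_sum_Icc hb0 hb1]
    ring
  simp_rw [heq]
  constructor
  · intro hs
    refine (hs.mul_left 2).of_nonneg_of_le (fun n => mul_nonneg ?_ (hterm (n + 1))) fun n => ?_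
    · exact zero_le_one.trans (hratio n).1
    · exact mul_le_mul_of_nonneg_right (hratio n).2 (hterm (n + 1))
  · intro hs
    exact hs.of_nonneg_of_le (fun n => hterm (n + 1))
      fun n => le_mul_of_one_le_left (hterm (n + 1)) (hratio n).1

/-- If `b' ≤ b` eventually, the partial sums of `b'` are bounded by a multiple of those of `b`. -/
theorem exists_sum_Icc_le_mul_sum_Icc {b b' : ℕ → ℝ} (hb0 : ∀ n, 1 ≤ n → 0 ≤ b n)
    (hb1 : b 1 = 1) (hle : ∀ᶠ n in atTop, b' n ≤ b n) :
    ∃ C : ℝ, 0 ≤ C ∧ ∀ n : ℕ,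
      ∑ k ∈ Finset.Icc 1 (n + 1), b' k ≤ C * ∑ k ∈ Finset.Icc 1 (n + 1), b k := by
  obtain ⟨N, hN⟩ := eventually_atTop.1 hle
  set D : ℝ := ∑ k ∈ Finset.range N, |b' k - b k| with hD
  have hD0 : 0 ≤ D := Finset.sum_nonneg fun _ _ => abs_nonneg _
  refine ⟨1 + D, by positivity, fun n => ?_⟩
  have hdiff : ∑ k ∈ Finset.Icc 1 (n + 1), (b' k - b k) ≤ D := by
    calc ∑ k ∈ Finset.Icc 1 (n + 1), (b' k - b k)
        ≤ ∑ k ∈ Finset.Icc 1 (n + 1), if k < N then |b' k - b k| else 0 := by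
          refine Finset.sum_le_sum fun k _ => ?_
          split_ifs with hk
          · exact le_abs_self _
          · exact sub_nonpos.2 (hN k (not_lt.1 hk))
      _ = ∑ k ∈ Finset.Icc 1 (n + 1) with k < N, |b' k - b k| := (Finset.sum_filter _ _).symm
      _ ≤ D := Finset.sum_le_sum_of_subset_of_nonneg
          (fun k hk => Finset.mem_range.2 (Finset.mem_filter.1 hk).2) fun _ _ _ => abs_nonneg _
  rw [Finset.sum_sub_distrib] at hdiff
  nlinarith [one_le_sum_Icc hb0 hb1 n]

/-- asymptotic comparison lemma. Let `a, b, a', b'` be nonincreasing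
`[0,1]`-valued sequences (indexed by `n ≥ 1`) with first term `1` and divergent series, such
that eventually `a_n ≤ a'_n` and `b_n ≥ b'_n`. If the series `K` associated with `(a, b)`
diverges, then so does the series `K'` associated with `(a', b')`. -/
theorem asymptotic_comparison (a b a' b' : ℕ → ℝ)
    (hamono : ∀ n, 1 ≤ n → a (n + 1) ≤ a n) (hbmono : ∀ n, 1 ≤ n → b (n + 1) ≤ b n)
    (hamono' : ∀ n, 1 ≤ n → a' (n + 1) ≤ a' n) (hbmono' : ∀ n, 1 ≤ n → b' (n + 1) ≤ b' n)
    (ha01 : ∀ n, 1 ≤ n → a n ∈ Set.Icc (0 : ℝ) 1)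
    (hb01 : ∀ n, 1 ≤ n → b n ∈ Set.Icc (0 : ℝ) 1)
    (ha01' : ∀ n, 1 ≤ n → a' n ∈ Set.Icc (0 : ℝ) 1)
    (hb01' : ∀ n, 1 ≤ n → b' n ∈ Set.Icc (0 : ℝ) 1)
    (ha1 : a 1 = 1) (hb1 : b 1 = 1) (ha1' : a' 1 = 1) (hb1' : b' 1 = 1)
    (hadiv : ¬ Summable fun n => a (n + 1)) (hbdiv : ¬ Summable fun n => b (n + 1))
    (hadiv' : ¬ Summable fun n => a' (n + 1)) (hbdiv' : ¬ Summable fun n => b' (n + 1))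
    (hcomp : ∀ᶠ n in atTop, a n ≤ a' n ∧ b' n ≤ b n)
    (hK : ¬ Summable fun n : ℕ =>
        (1 - ((n : ℝ) + 1) * b (n + 1) / ∑ k ∈ Finset.Icc 1 (n + 1), b k) *
          (a (n + 1) / ∑ k ∈ Finset.Icc 1 (n + 1), b k)) :
    ¬ Summable fun n : ℕ =>
        (1 - ((n : ℝ) + 1) * b' (n + 1) / ∑ k ∈ Finset.Icc 1 (n + 1), b' k) *
          (a' (n + 1) / ∑ k ∈ Finset.Icc 1 (n + 1), b' k) := by
  have ha0 n (hn : 1 ≤ n) := (ha01 n hn).1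
  have hb0 n (hn : 1 ≤ n) := (hb01 n hn).1
  have ha0' n (hn : 1 ≤ n) := (ha01' n hn).1
  have hb0' n (hn : 1 ≤ n) := (hb01' n hn).1
  rw [summable_iff_summable_mul_sub hbmono ha0 hb0 hb1] at hK
  rw [summable_iff_summable_mul_sub hbmono' ha0' hb0' hb1']
  contrapose! hK
  obtain ⟨C, hC, hBC⟩ := exists_sum_Icc_le_mul_sum_Icc hb0 hb1 (hcomp.mono fun _ h => h.2)
  have hmono' := monotone_div_sum_Icc hbmono' hb0' hb1'
  refine summable_mul_sub_of_le_mul (α := fun n => a (n + 1))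
    (g := fun n : ℕ => ((n : ℝ) + 1) / ∑ k ∈ Finset.Icc 1 (n + 1), b k)
    (h := fun n : ℕ => ((n : ℝ) + 1) / ∑ k ∈ Finset.Icc 1 (n + 1), b' k) (C := C)
    (antitone_nat_of_succ_le fun n => hamono (n + 1) (by omega)) (fun n => ha0 _ (by omega))
    (monotone_div_sum_Icc hbmono hb0 hb1) (by simp [hb1]) hmono' hC (fun n => ?_) ?_
  · have h1 := one_le_sum_Icc hb0 hb1 n
    have h2 := one_le_sum_Icc hb0' hb1' n
    rw [← mul_div_assoc, div_le_div_iff₀ (by positivity) (by positivity)]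
    calc ((n : ℝ) + 1) * ∑ k ∈ Finset.Icc 1 (n + 1), b' k
        ≤ ((n : ℝ) + 1) * (C * ∑ k ∈ Finset.Icc 1 (n + 1), b k) :=
          mul_le_mul_of_nonneg_left (hBC n) (by positivity)
      _ = _ := by ring
  · obtain ⟨N, hN⟩ := eventually_atTop.1 hcomp
    have hinc (n : ℕ) := sub_nonneg.2 (hmono' n.le_succ)
    rw [← summable_nat_add_iff N] at hK ⊢
    exact hK.of_nonneg_of_le (fun n => mul_nonneg (ha0 _ (by omega)) (hinc (n + N)))
      fun n => mul_le_mul_of_nonneg_right (hN (n + N + 1 + 1) (by omega)).1 (hinc (n + N))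
end

section
/- (Asymptotics of the distribution tails.) Fix an integer p ≥ 0 and positive reals λ_0, λ_1, …, λ_p. Write log_[j] for the j-fold iterate of the natural logarithm (log_[0](x) = x). Let (α_n)_{n≥1} be a sequence with values in [0,1) such that for some N, large enough that all iterated logarithms involved are > 1 on [N,∞), one has for all n ≥ N: α_n = λ_0/n + λ_1/(n log n) + ⋯ + λ_p/(n · log_[1](n) ⋯ log_[p](n)). Then the products 𝒯(n) := ∏_{k=1}^{n−1}(1 − α_k) satisfy 𝒯(n) ≍ 1/(n^{λ_0} (log n)^{λ_1} ⋯ (log_[p](n))^{λ_p}), i.e. there exists c > 0 such that for all sufficiently large n, c^{-1} ≤ 𝒯(n) · n^{λ_0} (log n)^{λ_1} ⋯ (log_[p](n))^{λ_p} ≤ c. -/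
open Filter

/-- `n · log n ⋯ log_[j] n` (with `log_[0] x = x`). -/
noncomputable def logProd (j : ℕ) (n : ℕ) : ℝ :=
  ∏ i ∈ Finset.range (j + 1), Real.log^[i] (n : ℝ)

theorem iterate_log_forward_diff_mem_Icc {p N : ℕ}
    (hN : ∀ j ≤ p, ∀ n : ℕ, N ≤ n → 1 < Real.log^[j] (n : ℝ)) {n : ℕ} (hn : N ≤ n) :
    ∀ j ≤ p + 1, Real.log^[j] ((n + 1 : ℕ) : ℝ) - Real.log^[j] (n : ℝ) ∈
      Set.Icc (∏ i ∈ Finset.range j, Real.log^[i] ((n + 1 : ℕ) : ℝ))⁻¹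
        (∏ i ∈ Finset.range j, Real.log^[i] (n : ℝ))⁻¹ := by
  intro j
  induction j with
  | zero => intro _; simp
  | succ j ih =>
    intro hj
    obtain ⟨h1, h2⟩ := ih (by omega)
    have hx : 0 < Real.log^[j] (n : ℝ) := by linarith [hN j (by omega) n hn]
    have hy : 0 < Real.log^[j] ((n + 1 : ℕ) : ℝ) := by
      linarith [hN j (by omega) (n + 1) (by omega)]
    rw [Finset.prod_range_succ, Finset.prod_range_succ, Function.iterate_succ_apply',
      Function.iterate_succ_apply', mul_inv, mul_inv, ← Real.log_div hy.ne' hx.ne']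
    constructor
    · refine le_trans (mul_le_mul_of_nonneg_right h1 (inv_nonneg.2 hy.le)) ?_
      refine le_trans (le_of_eq ?_) (Real.one_sub_inv_le_log_of_pos (div_pos hy hx))
      field_simp
    · refine le_trans ?_ (mul_le_mul_of_nonneg_right h2 (inv_nonneg.2 hx.le))
      refine (Real.log_le_sub_one_of_pos (div_pos hy hx)).trans (le_of_eq ?_)
      field_simp

theorem natCast_le_logProd {p N : ℕ}
    (hN : ∀ j ≤ p, ∀ n : ℕ, N ≤ n → 1 < Real.log^[j] (n : ℝ)) {n : ℕ} (hn : N ≤ n)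
    {j : ℕ} (hj : j ≤ p) : (n : ℝ) ≤ logProd j n := by
  have h : (1 : ℝ) ≤ ∏ i ∈ Finset.range j, Real.log^[i + 1] (n : ℝ) := by
    rw [← Finset.prod_const_one (s := Finset.range j)]
    refine Finset.prod_le_prod (fun _ _ => zero_le_one) fun i hi => ?_
    exact (hN (i + 1) (by have := Finset.mem_range.1 hi; omega) n hn).le
  rw [logProd, Finset.prod_range_succ']
  simpa using le_mul_of_one_le_left (Nat.cast_nonneg n) h

theorem neg_sub_two_mul_sq_le_log_one_sub {x : ℝ} (h1 : x ≤ 1 / 2) :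
    -x - 2 * x ^ 2 ≤ Real.log (1 - x) := by
  refine le_trans ?_ (Real.one_sub_inv_le_log_of_pos (by linarith))
  have hx : 0 < 1 - x := by linarith
  rw [← sub_nonneg]
  have : 1 - (1 - x)⁻¹ - (-x - 2 * x ^ 2) = x ^ 2 * (1 - 2 * x) / (1 - x) := by
    field_simp
    ring
  rw [this]
  have : 0 ≤ 1 - 2 * x := by linarith
  positivity

/-- asymptotics of the distribution tails. If, for large `n`,
`α_n = λ_0/n + λ_1/(n log n) + ⋯ + λ_p/(n · log n ⋯ log_[p] n)` with positive `λ_j`, then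
the tails `𝒯(n) = ∏_{k=1}^{n−1} (1 − α_k)` are of the same order as
`1/(n^{λ_0} (log n)^{λ_1} ⋯ (log_[p] n)^{λ_p})`. -/
theorem tail_asymptotics (p : ℕ) (lam : ℕ → ℝ) (hlam : ∀ j, j ≤ p → 0 < lam j)
    (α : ℕ → ℝ) (hα : ∀ n, 1 ≤ n → α n ∈ Set.Ico (0 : ℝ) 1)
    (N : ℕ) (hN : ∀ j ≤ p, ∀ n : ℕ, N ≤ n → 1 < Real.log^[j] (n : ℝ))
    (hform : ∀ n : ℕ, N ≤ n →
      α n = ∑ j ∈ Finset.range (p + 1), lam j / logProd j n) :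
    ∃ c > (0 : ℝ), ∀ᶠ n : ℕ in atTop,
      c⁻¹ ≤ (∏ k ∈ Finset.Icc 1 (n - 1), (1 - α k)) *
          ∏ j ∈ Finset.range (p + 1), Real.log^[j] (n : ℝ) ^ lam j ∧
      (∏ k ∈ Finset.Icc 1 (n - 1), (1 - α k)) *
          ∏ j ∈ Finset.range (p + 1), Real.log^[j] (n : ℝ) ^ lam j ≤ c := by
  have hL : ∀ j ≤ p, ∀ n : ℕ, N ≤ n → 0 < Real.log^[j] (n : ℝ) := fun j hj n hn =>
    one_pos.trans (hN j hj n hn)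
  set T : ℕ → ℝ := fun n => ∏ k ∈ Finset.Icc 1 (n - 1), (1 - α k) with hT
  set D : ℕ → ℝ := fun n => ∏ j ∈ Finset.range (p + 1), Real.log^[j] (n : ℝ) ^ lam j with hD
  set f : ℕ → ℝ := fun n => ∑ j ∈ Finset.range (p + 1), lam j * Real.log^[j + 1] (n : ℝ) with hf
  set Λ : ℝ := ∑ j ∈ Finset.range (p + 1), lam j with hΛ
  have hTpos : ∀ n, 0 < T n := fun n => Finset.prod_pos fun k hk => by
    linarith [(hα k (Finset.mem_Icc.1 hk).1).2]
  have hDpos : ∀ n, N ≤ n → 0 < D n := fun n hn => Finset.prod_pos fun j hj =>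
    Real.rpow_pos_of_pos (hL j (by have := Finset.mem_range.1 hj; omega) n hn) _
  have hDf : ∀ n, N ≤ n → Real.log (D n) = f n := by
    intro n hn
    have hp : ∀ j ∈ Finset.range (p + 1), 0 < Real.log^[j] (n : ℝ) := fun j hj =>
      hL j (by have := Finset.mem_range.1 hj; omega) n hn
    rw [hD, hf, Real.log_prod fun j hj => (Real.rpow_pos_of_pos (hp j hj) _).ne']
    refine Finset.sum_congr rfl fun j hj => ?_
    rw [Real.log_rpow (hp j hj), Function.iterate_succ_apply']
  have hTsucc : ∀ n, 1 ≤ n → T (n + 1) = T n * (1 - α n) := by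
    intro n hn
    obtain ⟨m, rfl⟩ := Nat.exists_eq_add_of_le' hn
    simp only [hT, Nat.add_sub_cancel]
    exact Finset.prod_Icc_succ_top (by omega) _
  have hfdiff : ∀ n, N ≤ n → α (n + 1) ≤ f (n + 1) - f n ∧ f (n + 1) - f n ≤ α n := by
    intro n hn
    rw [hform n hn, hform (n + 1) (by omega), hf, ← Finset.sum_sub_distrib]
    constructor <;> refine Finset.sum_le_sum fun j hj => ?_ <;>
    · have hj' : j ≤ p := by have := Finset.mem_range.1 hj; omega
      obtain ⟨h1, h2⟩ := iterate_log_forward_diff_mem_Icc hN hn (j + 1) (by omega)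
      rw [← mul_sub, div_eq_mul_inv]
      exact mul_le_mul_of_nonneg_left (by assumption) (hlam j hj').le
  have hαle : ∀ n, N ≤ n → α n ≤ Λ / n := by
    intro n hn
    rw [hform n hn, hΛ, Finset.sum_div]
    refine Finset.sum_le_sum fun j hj => ?_
    have hj' : j ≤ p := by have := Finset.mem_range.1 hj; omega
    exact div_le_div_of_nonneg_left (hlam j hj').le (hL 0 (by omega) n hn)
      (natCast_le_logProd hN hn hj')
  obtain ⟨K, hK⟩ := exists_nat_ge (2 * Λ)
  set M : ℕ := max (max N K) 2 with hM
  have hMN : N ≤ M := by omega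
  have hMK : K ≤ M := by omega
  have hM2 : 2 ≤ M := by omega
  set a : ℕ → ℝ := fun n => Real.log (T n) + f n with ha
  have hasucc : ∀ n, M ≤ n → a (n + 1) = a n + Real.log (1 - α n) + (f (n + 1) - f n) := by
    intro n hn
    have := (hα n (by omega)).2
    simp only [ha]
    rw [hTsucc n (by omega), Real.log_mul (hTpos n).ne' (by linarith)]
    ring
  have hupper : ∀ n, M ≤ n → a n ≤ a M := by
    intro n hn
    induction n, hn using Nat.le_induction with
    | base => exact le_rfl
    | succ n hn ih =>
      have h1 := Real.log_le_sub_one_of_pos (x := 1 - α n) (by linarith [(hα n (by omega)).2])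
      linarith [hasucc n hn, (hfdiff n (by omega)).2]
  set b : ℕ → ℝ := fun n => a n - α n - 2 * Λ ^ 2 / ((n : ℝ) - 1) with hb
  have hlower : ∀ n, M ≤ n → b M ≤ b n := by
    intro n hn
    induction n, hn using Nat.le_induction with
    | base => exact le_rfl
    | succ n hn ih =>
      have hn2 : (2 : ℝ) ≤ n := by exact_mod_cast hM2.trans hn
      have hn1 : (0 : ℝ) < n - 1 := by linarith
      have hn0 : (0 : ℝ) < n := by linarith
      have hnK : (K : ℝ) ≤ n := by exact_mod_cast hMK.trans hn
      have hα0 := (hα n (by omega)).1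
      have hα1 := hαle n (by omega)
      have hα2 : α n ≤ 1 / 2 := hα1.trans (by rw [div_le_iff₀ hn0]; linarith)
      have h1 := neg_sub_two_mul_sq_le_log_one_sub hα2
      have h2 : α n ^ 2 ≤ (Λ / n) ^ 2 := pow_le_pow_left₀ hα0 hα1 2
      have h3 : 2 * (Λ / n) ^ 2 ≤ 2 * Λ ^ 2 / ((n : ℝ) - 1) - 2 * Λ ^ 2 / n := by
        rw [← sub_nonneg]
        have : 2 * Λ ^ 2 / ((n : ℝ) - 1) - 2 * Λ ^ 2 / n - 2 * (Λ / n) ^ 2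
            = 2 * Λ ^ 2 / (n ^ 2 * (n - 1)) := by
          field_simp
          ring
        rw [this]
        positivity
      refine ih.trans ?_
      simp only [hb]
      push_cast
      rw [add_sub_cancel_right]
      linarith [hasucc n hn, (hfdiff n (by omega)).1]
  have hba : ∀ n, M ≤ n → b n ≤ a n := by
    intro n hn
    have hn2 : (2 : ℝ) ≤ n := by exact_mod_cast hM2.trans hn
    have : 0 ≤ 2 * Λ ^ 2 / ((n : ℝ) - 1) := div_nonneg (by positivity) (by linarith)
    simp only [hb]
    linarith [(hα n (by omega)).1]
  refine ⟨Real.exp (max (a M) (-b M)), Real.exp_pos _, ?_⟩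
  filter_upwards [eventually_ge_atTop M] with n hn
  have hexp : T n * D n = Real.exp (a n) := by
    have hDn := hDpos n (by omega)
    simp only [ha]
    rw [← hDf n (by omega), Real.exp_add, Real.exp_log (hTpos n), Real.exp_log hDn]
  change _ ≤ T n * D n ∧ T n * D n ≤ _
  rw [hexp, ← Real.exp_neg, Real.exp_le_exp, Real.exp_le_exp]
  constructor
  · linarith [le_max_right (a M) (-b M), hlower n hn, hba n hn]
  · exact (hupper n hn).trans (le_max_left _ _)
end
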